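/- arXiv:1708.06461 — 2 statements merged into one kernel-verified Lean document; each statement's English description precedes it below -/
import Mathlib

section
/- For even n ≥ 6, the number of binary partial words of length n with exactly one hole, located at a position i with 0 ≤ i ≤ n/2 − 1, whose first non-hole character is 0, whose first half (positions 0 through n/2 − 1) contains exactly two occurrences of the letter 0, and whose minimal abelian border length equals n−1, is n²/4 − n/2 − 2. -/
/-- A partial word over alphabet `α` is a list over `Option α`; `none` is a hole. -/
abbrev PWord (α : Type*) := List (Option α)

/-- `c` is a completion of the partial word `w`: a total word of the same length
agreeing with `w` on every non-hole position. -/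
def IsCompletion {α : Type*} (w : PWord α) (c : List α) : Prop :=
  List.Forall₂ (fun o a => ∀ x, o = some x → x = a) w c

/-- Two partial words are abelian compatible if they admit completions that are
permutations of one another (abelian equivalent). -/
def AbelianCompat {α : Type*} (u v : PWord α) : Prop :=
  ∃ cu cv, IsCompletion u cu ∧ IsCompletion v cv ∧ cu.Perm cv

/-- A partial word `w` has an abelian border of length `k`, `1 ≤ k ≤ |w| - 1`, if
its prefix of length `k` is abelian compatible with its suffix of length `k`. -/
def HasAbelianBorder {α : Type*} (w : PWord α) (k : ℕ) : Prop :=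
  1 ≤ k ∧ k ≤ w.length - 1 ∧ AbelianCompat (w.take k) (w.drop (w.length - k))

/-- A total word `w` has an abelian border of length `k`, `1 ≤ k ≤ |w| - 1`, if
its prefix of length `k` is a permutation of its suffix of length `k`. -/
def HasAbelianBorderT {α : Type*} (w : List α) (k : ℕ) : Prop :=
  1 ≤ k ∧ k ≤ w.length - 1 ∧ (w.take k).Perm (w.drop (w.length - k))

/-- The first non-hole character of the binary partial word `w` is the letter `0`:
some position `j` holds the letter `0` and all earlier positions are holes. -/
def FirstLetterIsZero (w : PWord (Fin 2)) : Prop :=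
  ∃ j, (∀ l, l < j → w.getD l none = none) ∧ w.getD j none = some 0

/-- Number of occurrences of the letter `0` among the first `k` positions. -/
def zeroCount (w : PWord (Fin 2)) (k : ℕ) : ℕ := (w.take k).count (some 0)

/-- Number of holes among the first `k` positions. -/
def holeCount (w : PWord (Fin 2)) (k : ℕ) : ℕ := (w.take k).count none

theorem IsCompletion.count_bounds {u : PWord (Fin 2)} {c : List (Fin 2)} (h : IsCompletion u c) :
    u.count (some 0) ≤ c.count 0 ∧ c.count 0 ≤ u.count (some 0) + u.count none := by
  unfold IsCompletion at h
  induction h with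
  | nil => simp
  | @cons o a u c ho _ ih =>
    simp only [List.count_cons]
    rcases o with _ | x
    · simp only [beq_iff_eq, reduceCtorEq, if_false, if_true]
      split_ifs <;> omega
    · obtain rfl := ho x rfl
      simp only [beq_iff_eq, reduceCtorEq, if_false, Option.some.injEq]
      split_ifs <;> omega

theorem exists_completion_count {u : PWord (Fin 2)} {t : ℕ} (h₁ : u.count (some 0) ≤ t)
    (h₂ : t ≤ u.count (some 0) + u.count none) :
    ∃ c, IsCompletion u c ∧ c.count 0 = t := by
  induction u generalizing t with
  | nil => exact ⟨[], List.Forall₂.nil, by simp at h₂; simp [h₂]⟩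
  | cons o u ih =>
    simp only [List.count_cons] at h₁ h₂
    rcases o with _ | x
    · simp only [beq_iff_eq, reduceCtorEq, if_false, if_true] at h₁ h₂
      by_cases ht : t = u.count (some 0)
      · obtain ⟨c, hc, hct⟩ := ih (t := t) (by omega) (by omega)
        exact ⟨1 :: c, List.Forall₂.cons (by simp) hc, by simp [hct]⟩
      · obtain ⟨c, hc, hct⟩ := ih (t := t - 1) (by omega) (by omega)
        exact ⟨0 :: c, List.Forall₂.cons (by simp) hc, by
          simp only [List.count_cons, hct, beq_self_eq_true, if_true]; omega⟩
    · simp only [beq_iff_eq, reduceCtorEq, if_false, Option.some.injEq] at h₁ h₂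
      obtain ⟨c, hc, hct⟩ := ih (t := t - if x = 0 then 1 else 0)
        (by split_ifs at * <;> omega) (by split_ifs at * <;> omega)
      refine ⟨x :: c, List.Forall₂.cons (by simp) hc, ?_⟩
      simp only [List.count_cons, hct, beq_iff_eq]
      split_ifs at * <;> omega

theorem count_zero_add_count_one (c : List (Fin 2)) : c.count 0 + c.count 1 = c.length := by
  induction c with
  | nil => rfl
  | cons a c ih =>
    simp only [List.count_cons, List.length_cons]
    fin_cases a <;> simp <;> omega

theorem abelianCompat_iff {u v : PWord (Fin 2)} (huv : u.length = v.length) :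
    AbelianCompat u v ↔ u.count (some 0) ≤ v.count (some 0) + v.count none ∧
      v.count (some 0) ≤ u.count (some 0) + u.count none := by
  constructor
  · rintro ⟨cu, cv, hu, hv, hp⟩
    have := hu.count_bounds
    have := hv.count_bounds
    have := hp.count_eq 0
    omega
  · rintro ⟨h₁, h₂⟩
    obtain ⟨cu, hu, hcu⟩ := exists_completion_count (u := u)
      (t := max (u.count (some 0)) (v.count (some 0))) (by omega) (by omega)
    obtain ⟨cv, hv, hcv⟩ := exists_completion_count (u := v)
      (t := max (u.count (some 0)) (v.count (some 0))) (by omega) (by omega)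
    refine ⟨cu, cv, hu, hv, List.perm_iff_count.2 fun a => ?_⟩
    have := count_zero_add_count_one cu
    have := count_zero_add_count_one cv
    have := List.Forall₂.length_eq hu
    have := List.Forall₂.length_eq hv
    fin_cases a <;> simp <;> omega

theorem count_take_add_count_drop (w : PWord (Fin 2)) (a : Option (Fin 2)) (k : ℕ) :
    (w.take k).count a + (w.drop k).count a = w.count a := by
  rw [← List.count_append, List.take_append_drop]

theorem hasAbelianBorder_iff (w : PWord (Fin 2)) (k : ℕ) :
    HasAbelianBorder w k ↔ 1 ≤ k ∧ k ≤ w.length - 1 ∧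
      zeroCount w k + zeroCount w (w.length - k) + holeCount w (w.length - k) ≤
        zeroCount w w.length + holeCount w w.length ∧
      zeroCount w w.length ≤ zeroCount w k + zeroCount w (w.length - k) + holeCount w k := by
  unfold HasAbelianBorder
  refine and_congr_right fun h₁ => and_congr_right fun h₂ => ?_
  rw [abelianCompat_iff (by simp; omega)]
  have hz := count_take_add_count_drop w (some 0) (w.length - k)
  have hh := count_take_add_count_drop w none (w.length - k)
  simp only [zeroCount, holeCount, List.take_length]
  omega

theorem zeroCount_succ (w : PWord (Fin 2)) (k : ℕ) :
    zeroCount w (k + 1) = zeroCount w k + if w[k]? = some (some 0) then 1 else 0 := by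
  unfold zeroCount
  rw [List.take_add_one, List.count_append]
  rcases w[k]? with _ | o <;> simp [List.count_cons]

theorem holeCount_succ (w : PWord (Fin 2)) (k : ℕ) :
    holeCount w (k + 1) = holeCount w k + if w[k]? = some none then 1 else 0 := by
  unfold holeCount
  rw [List.take_add_one, List.count_append]
  rcases w[k]? with _ | o <;> simp [List.count_cons]

theorem zeroCount_mono (w : PWord (Fin 2)) : Monotone (zeroCount w) :=
  monotone_nat_of_le_succ fun k => by rw [zeroCount_succ]; omega

theorem holeCount_mono (w : PWord (Fin 2)) : Monotone (holeCount w) :=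
  monotone_nat_of_le_succ fun k => by rw [holeCount_succ]; omega

theorem zeroCount_zero (w : PWord (Fin 2)) : zeroCount w 0 = 0 := by simp [zeroCount]

theorem holeCount_zero (w : PWord (Fin 2)) : holeCount w 0 = 0 := by simp [holeCount]

theorem countP_isNone (w : PWord (Fin 2)) : w.countP (·.isNone) = holeCount w w.length := by
  rw [holeCount, List.take_length, List.count]
  congr 1
  funext o
  cases o <;> rfl

theorem holeCount_eq_ite {w : PWord (Fin 2)} {i : ℕ} (hi : w[i]? = some none)
    (h : holeCount w w.length = 1) {k : ℕ} (hk : k ≤ w.length) :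
    holeCount w k = if i < k then 1 else 0 := by
  have hs := holeCount_succ w i
  rw [if_pos hi] at hs
  have hil : i < w.length := (List.getElem?_eq_some_iff.1 hi).1
  have h₁ := holeCount_mono w (show i + 1 ≤ w.length by omega)
  have h₂ := holeCount_mono w hk
  split_ifs with hik
  · have := holeCount_mono w (show i + 1 ≤ k by omega)
    omega
  · have := holeCount_mono w (show k ≤ i by omega)
    omega

/-- A monotone function growing by exactly one over `[a, b]` jumps
exactly once. -/
theorem exists_unit_jump {f : ℕ → ℕ} (hf : Monotone f) {a b : ℕ}
    (h : f b = f a + 1) :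
    ∃ q, a ≤ q ∧ q < b ∧ (∀ j, a ≤ j → j ≤ q → f j = f a) ∧
      ∀ j, q < j → j ≤ b → f j = f a + 1 := by
  have hne : ∃ j, f a < f j := ⟨b, by omega⟩
  have hle : Nat.find hne ≤ b := Nat.find_le (by omega)
  have hlt : f a < f (Nat.find hne) := Nat.find_spec hne
  have ha : a < Nat.find hne := by
    by_contra hcon
    have := hf (show Nat.find hne ≤ a by omega)
    omega
  refine ⟨Nat.find hne - 1, by omega, by omega, fun j h₁ h₂ => ?_, fun j h₁ h₂ => ?_⟩
  · have := Nat.find_min hne (show j < Nat.find hne by omega)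
    have := hf h₁
    omega
  · have := hf h₂
    have := hf (show Nat.find hne ≤ j by omega)
    omega

/-- The word of length `m + m` with its hole at `i`, letter `0` at the positions `0`, `p` and,
if `m ≤ q`, also at `q`, and letter `1` elsewhere. -/
def sparseWord (m i p q : ℕ) : PWord (Fin 2) :=
  (List.range (m + m)).map fun j =>
    if j = i then none else if j = 0 ∨ j = p ∨ j = q ∧ m ≤ q then some 0 else some 1

theorem length_sparseWord (m i p q : ℕ) : (sparseWord m i p q).length = m + m := by
  simp [sparseWord]

theorem getElem?_sparseWord {m j : ℕ} (i p q : ℕ) (hj : j < m + m) :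
    (sparseWord m i p q)[j]? = some (if j = i then none else
      if j = 0 ∨ j = p ∨ j = q ∧ m ≤ q then some 0 else some 1) := by
  simp [sparseWord, hj]

theorem getElem?_sparseWord_eq_none_iff {m j : ℕ} (i p q : ℕ) (hj : j < m + m) :
    (sparseWord m i p q)[j]? = some none ↔ j = i := by
  rw [getElem?_sparseWord i p q hj]
  split_ifs <;> simp_all

theorem getElem?_sparseWord_eq_zero_iff {m j : ℕ} (i p q : ℕ) (hj : j < m + m) :
    (sparseWord m i p q)[j]? = some (some 0) ↔ j ≠ i ∧ (j = 0 ∨ j = p ∨ j = q ∧ m ≤ q) := by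
  rw [getElem?_sparseWord i p q hj]
  by_cases h₁ : j = i
  · simp [h₁]
  · by_cases h₂ : j = 0 ∨ j = p ∨ j = q ∧ m ≤ q
    · simp only [if_neg h₁, if_pos h₂]
      tauto
    · simp only [if_neg h₁, if_neg h₂]
      exact iff_of_false (by decide) (by tauto)

theorem zeroCount_sparseWord {m i p q k : ℕ} (hi : 0 < i) (hip : i ≠ p) (hp : 0 < p) (hpm : p < m)
    (him : i < m) (hk : k ≤ m + m) :
    zeroCount (sparseWord m i p q) k = (if 0 < k then 1 else 0) + (if p < k then 1 else 0) +
      if q < k ∧ m ≤ q then 1 else 0 := by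
  induction k with
  | zero => simp [zeroCount_zero]
  | succ k ih =>
    rw [zeroCount_succ, ih (by omega)]
    simp only [getElem?_sparseWord_eq_zero_iff i p q (show k < m + m by omega)]
    by_cases hq : m ≤ q
    · simp only [hq, and_true]
      split_ifs <;> omega
    · simp only [hq, and_false, or_false, if_false]
      split_ifs <;> omega

theorem holeCount_sparseWord {m i k : ℕ} (p q : ℕ) (hk : k ≤ m + m) :
    holeCount (sparseWord m i p q) k = if i < k then 1 else 0 := by
  induction k with
  | zero => simp [holeCount_zero]
  | succ k ih =>
    rw [holeCount_succ, ih (by omega)]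
    simp only [getElem?_sparseWord_eq_none_iff i p q (show k < m + m by omega)]
    split_ifs <;> omega

theorem sparseWord_inj {m i p q i' p' q' : ℕ} (him : i < m) (hp : 0 < p)
    (hpm : p < m) (hip : i ≠ p) (hq : m - 1 ≤ q) (hqm : q < m + m)
    (hq' : m - 1 ≤ q') (hqm' : q' < m + m)
    (h : sparseWord m i p q = sparseWord m i' p' q') : i = i' ∧ p = p' ∧ q = q' := by
  have hz (j : ℕ) (hj : j < m + m) : (j ≠ i ∧ (j = 0 ∨ j = p ∨ j = q ∧ m ≤ q)) ↔
      j ≠ i' ∧ (j = 0 ∨ j = p' ∨ j = q' ∧ m ≤ q') := by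
    rw [← getElem?_sparseWord_eq_zero_iff i p q hj, h, getElem?_sparseWord_eq_zero_iff _ _ _ hj]
  have hh : i = i' := by
    rw [← getElem?_sparseWord_eq_none_iff i' p' q' (show i < m + m by omega), ← h,
      getElem?_sparseWord_eq_none_iff _ _ _ (by omega)]
  have hpp : p = p' := by
    have := hz p (by omega)
    omega
  refine ⟨hh, hpp, ?_⟩
  have := hz q (by omega)
  have := hz q' (by omega)
  omega

/-- The words counted by the theorem, for length `m + m`. -/
def IsCounted (m : ℕ) (w : PWord (Fin 2)) : Prop :=
  w.length = m + m ∧ w.countP (·.isNone) = 1 ∧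
    (∃ i, i ≤ m - 1 ∧ w.getD i (some 0) = none) ∧ FirstLetterIsZero w ∧
    (w.take m).count (some 0) = 2 ∧ IsLeast {k | HasAbelianBorder w k} (m + m - 1)

theorem isCounted_sparseWord {m i p q : ℕ} (hi : 0 < i) (him : i < m) (hp : 0 < p) (hpm : p < m)
    (hip : i ≠ p) (h₁ : i = 1 ∨ p = 1) (hqi : q + i < m + m) (hqp : q + p < m + m) :
    IsCounted m (sparseWord m i p q) := by
  have hl := length_sparseWord m i p q
  have hz (k : ℕ) (hk : k ≤ m + m) := zeroCount_sparseWord (q := q) hi hip hp hpm him hk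
  have hh (k : ℕ) (hk : k ≤ m + m) := holeCount_sparseWord (i := i) p q hk
  refine ⟨hl, ?_, ⟨i, by omega, ?_⟩, ⟨0, by simp, ?_⟩, ?_, ?_, ?_⟩
  · rw [countP_isNone, hl, hh _ le_rfl, if_pos (by omega)]
  · rw [List.getD_eq_getElem?_getD, getElem?_sparseWord i p q (by omega)]
    simp
  · rw [List.getD_eq_getElem?_getD, getElem?_sparseWord i p q (by omega)]
    simp [hi.ne]
  · have := hz m (by omega)
    rw [zeroCount] at this
    rw [this]
    split_ifs <;> omega
  · rw [Set.mem_ofPred_eq, hasAbelianBorder_iff, hl, hz _ le_rfl, hz _ (by omega), hz _ (by omega),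
      hh _ le_rfl, hh _ (by omega), hh _ (by omega)]
    simp only [show 0 < m + m - 1 by omega, show 0 < m + m by omega, show p < m + m by omega,
      show i < m + m by omega, show p < m + m - 1 by omega, show i < m + m - 1 by omega,
      show q < m + m by omega, show q < m + m - 1 by omega,
      show m + m - (m + m - 1) = 1 by omega, show ¬ p < 1 by omega, show ¬ i < 1 by omega,
      show ¬ (q < 1 ∧ m ≤ q) by omega, if_true, if_false, true_and, zero_lt_one]
    exact ⟨by omega, le_rfl, by omega, by omega⟩
  · intro k hk
    rw [Set.mem_ofPred_eq, hasAbelianBorder_iff, hl] at hk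
    obtain ⟨hk₁, hk₂, hk₃, -⟩ := hk
    rw [hz _ le_rfl, hz _ (by omega), hz _ (by omega), hh _ le_rfl, hh _ (by omega)] at hk₃
    rw [if_pos (show 0 < k by omega), if_pos (show 0 < m + m - k by omega),
      if_pos (show 0 < m + m by omega), if_pos (show p < m + m by omega),
      if_pos (show i < m + m by omega)] at hk₃
    by_cases hq : m ≤ q
    · simp only [hq, and_true, show q < m + m by omega, if_true] at hk₃
      split_ifs at hk₃ <;> omega
    · simp only [hq, and_false, if_false] at hk₃
      split_ifs at hk₃ <;> omega

theorem eq_sparseWord {m i p q : ℕ} {w : PWord (Fin 2)} (hl : w.length = m + m)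
    (hh : ∀ j < m + m, w[j]? = some none ↔ j = i)
    (hz : ∀ j < m + m, w[j]? = some (some 0) ↔ j = 0 ∨ j = p ∨ j = q ∧ m ≤ q) :
    w = sparseWord m i p q := by
  refine List.ext_getElem? fun j => ?_
  by_cases hj : j < m + m
  · rw [getElem?_sparseWord i p q hj]
    have h₁ := hh j hj
    have h₂ := hz j hj
    by_cases hi : j = i
    · rw [if_pos hi, h₁.2 hi]
    rw [if_neg hi]
    split_ifs with hp
    · exact h₂.2 hp
    · rw [← h₁] at hi
      rw [← h₂] at hp
      rw [List.getElem?_eq_getElem (by omega)] at hi hp ⊢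
      generalize w[j] = o at hi hp ⊢
      rcases o with _ | x
      · simp at hi
      · fin_cases x
        · simp at hp
        · rfl
  · rw [List.getElem?_eq_none (by omega),
      List.getElem?_eq_none (by rw [length_sparseWord]; omega)]

theorem IsCounted.exists_sparseWord {m : ℕ} {w : PWord (Fin 2)} (hm : 3 ≤ m)
    (hw : IsCounted m w) :
    ∃ i p q, 0 < i ∧ i < m ∧ 0 < p ∧ p < m ∧ i ≠ p ∧ (i = 1 ∨ p = 1) ∧ m - 1 ≤ q ∧
      q + i < m + m ∧ q + p < m + m ∧ w = sparseWord m i p q := by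
  obtain ⟨hl, hone, ⟨i, him, hi⟩, ⟨j₀, hj₁, hj₂⟩, htwo, -, hmin⟩ := hw
  rw [countP_isNone] at hone
  replace hi : w[i]? = some none := by
    rw [List.getD_eq_getElem?_getD, List.getElem?_eq_getElem (by omega)] at hi
    rw [List.getElem?_eq_getElem (by omega)]
    simpa using hi
  change zeroCount w m = 2 at htwo
  have hh (k : ℕ) (hk : k ≤ m + m) := holeCount_eq_ite hi hone (hl ▸ hk : k ≤ w.length)
  have hmono := zeroCount_mono w
  have hstep (k : ℕ) : zeroCount w (k + 1) ≤ zeroCount w k + 1 := by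
    rw [zeroCount_succ]; split_ifs <;> omega
  have hnb (k : ℕ) (hk₁ : 1 ≤ k) (hk₂ : k ≤ m + m - 2) :
      ¬ (zeroCount w k + zeroCount w (m + m - k) + (if i < m + m - k then 1 else 0) ≤
        zeroCount w (m + m) + 1 ∧
      zeroCount w (m + m) ≤
        zeroCount w k + zeroCount w (m + m - k) + if i < k then 1 else 0) := by
    intro hcon
    have : m + m - 1 ≤ k := by
      refine hmin ?_
      rw [Set.mem_ofPred_eq, hasAbelianBorder_iff, hone, hl, hh _ (by omega), hh _ (by omega)]
      exact ⟨hk₁, by omega, hcon⟩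
    omega
  have hz0 := zeroCount_zero w
  have hlast := hstep (m + m - 1)
  rw [show m + m - 1 + 1 = m + m by omega] at hlast
  have hi0 : 0 < i := by
    by_contra hcon
    obtain rfl : i = 0 := by omega
    have h₁ := hnb 1 le_rfl (by omega)
    have h₂ := zeroCount_succ w 0
    rw [hi, if_neg (by simp)] at h₂
    have := hmono (show m + m - 1 ≤ m + m by omega)
    simp only [zero_add] at h₂
    split_ifs at h₁ <;> omega
  have hw_hole (j : ℕ) (hj : j < m + m) : w[j]? = some none ↔ j = i := by
    refine ⟨fun h => ?_, fun h => h ▸ hi⟩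
    have h₁ := holeCount_succ w j
    rw [if_pos h, hh _ (by omega), hh _ (by omega)] at h₁
    split_ifs at h₁ <;> omega
  have hw0 : w[0]? = some (some 0) := by
    rcases Nat.eq_zero_or_pos j₀ with rfl | hpos
    · rw [List.getD_eq_getElem?_getD, List.getElem?_eq_getElem (by omega)] at hj₂
      rw [List.getElem?_eq_getElem (by omega)]
      simpa using hj₂
    · have h₁ := hj₁ 0 hpos
      have h₂ : w[0]? = some none := by
        rw [List.getD_eq_getElem?_getD, List.getElem?_eq_getElem (by omega)] at h₁
        rw [List.getElem?_eq_getElem (by omega)]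
        simpa using h₁
      have := (hw_hole 0 (by omega)).1 h₂
      omega
  have hz1 : zeroCount w 1 = 1 := by
    have := zeroCount_succ w 0
    rw [if_pos hw0] at this
    simpa [hz0] using this
  have hgt (k : ℕ) (hk₁ : 1 ≤ k) (hk₂ : k ≤ m) :
      zeroCount w (m + m) < zeroCount w k + zeroCount w (m + m - k) := by
    induction k, hk₁ using Nat.le_induction with
    | base =>
      have := hnb 1 le_rfl (by omega)
      split_ifs at this <;> omega
    | succ k hk ih =>
      have h₁ := ih (by omega)
      have h₂ := hnb (k + 1) (by omega) (by omega)
      have h₃ := hmono (show k ≤ k + 1 by omega)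
      have h₄ := hstep (m + m - (k + 1))
      rw [show m + m - (k + 1) + 1 = m + m - k by omega] at h₄
      split_ifs at h₂ <;> omega
  have hgt_hole (k : ℕ) (hk₁ : 2 ≤ k) (hk₂ : k ≤ i) :
      zeroCount w (m + m) + 2 ≤ zeroCount w k + zeroCount w (m + m - k) := by
    have h₁ := hgt k (by omega) (by omega)
    have h₂ := hnb (m + m - k) (by omega) (by omega)
    rw [show m + m - (m + m - k) = k by omega] at h₂
    split_ifs at h₂ <;> omega
  obtain ⟨p, hp₁, hpm, hpl, hpr⟩ := exists_unit_jump hmono (a := 1) (b := m) (by omega)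
  have hw_zero (j : ℕ) : w[j]? = some (some 0) ↔ zeroCount w (j + 1) = zeroCount w j + 1 := by
    rw [zeroCount_succ]
    split_ifs with h <;> simp [h]
  have hip : i ≠ p := by
    rintro rfl
    have h₁ := zeroCount_succ w i
    rw [hi, if_neg (by simp)] at h₁
    have := hpl i (by omega) le_rfl
    have := hpr (i + 1) (by omega) (by omega)
    omega
  have h1 : i = 1 ∨ p = 1 := by
    by_contra hcon
    have h₁ := hgt_hole 2 le_rfl (by omega)
    have h₂ := hpl 2 (by omega) (by omega)
    have := hmono (show m + m - 2 ≤ m + m by omega)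
    omega
  have htop : zeroCount w (m + m) ≤ 3 := by
    have := hgt m (by omega) le_rfl
    rw [show m + m - m = m by omega] at this
    omega
  have hbot := hmono (show m ≤ m + m by omega)
  have hfirst (j : ℕ) (hj : j < m) : w[j]? = some (some 0) ↔ j = 0 ∨ j = p := by
    rw [hw_zero]
    rcases Nat.eq_zero_or_pos j with rfl | hj0
    · simp [hz0, hz1]
    rcases lt_trichotomy j p with hjp | rfl | hjp
    · have := hpl j (by omega) (by omega)
      have := hpl (j + 1) (by omega) (by omega)
      omega
    · have := hpl j (by omega) (by omega)
      have := hpr (j + 1) (by omega) (by omega)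
      omega
    · have := hpr j (by omega) (by omega)
      have := hpr (j + 1) (by omega) (by omega)
      omega
  by_cases hc : zeroCount w (m + m) = 2
  · refine ⟨i, p, m - 1, hi0, by omega, hp₁, hpm, hip, h1, le_rfl, by omega, by omega,
      eq_sparseWord hl hw_hole fun j hj => ?_⟩
    by_cases hjm : j < m
    · rw [hfirst j hjm]
      omega
    · rw [hw_zero]
      have := hmono (show m ≤ j by omega)
      have := hmono (show j ≤ j + 1 by omega)
      have := hmono (show j + 1 ≤ m + m by omega)
      omega
  · obtain ⟨q, hmq, hqm, hql, hqr⟩ :=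
      exists_unit_jump hmono (a := m) (b := m + m) (by omega)
    have hbound (k : ℕ) (hk : k ≤ m) (h : zeroCount w (m + m - k) = 3) : q + k < m + m := by
      by_contra hcon
      have := hql (m + m - k) (by omega) (by omega)
      omega
    have hqp : q + p < m + m := by
      refine hbound p (by omega) ?_
      have := hgt p (by omega) (by omega)
      have := hpl p hp₁ le_rfl
      have := hmono (show m + m - p ≤ m + m by omega)
      omega
    have hqi : q + i < m + m := by
      rcases Nat.lt_or_ge i 2 with h | h
      · omega
      · refine hbound i (by omega) ?_
        have := hgt_hole i h le_rfl
        have := hmono (show i ≤ m by omega)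
        have := hmono (show m + m - i ≤ m + m by omega)
        omega
    refine ⟨i, p, q, hi0, by omega, hp₁, hpm, hip, h1, by omega, hqi, hqp,
      eq_sparseWord hl hw_hole fun j hj => ?_⟩
    by_cases hjm : j < m
    · rw [hfirst j hjm]
      omega
    · rw [hw_zero]
      rcases lt_trichotomy j q with hjq | rfl | hjq
      · have := hql j (by omega) (by omega)
        have := hql (j + 1) (by omega) (by omega)
        omega
      · have := hql j (by omega) (by omega)
        have := hqr (j + 1) (by omega) (by omega)
        omega
      · have := hqr j (by omega) (by omega)
        have := hqr (j + 1) (by omega) (by omega)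
        omega

/-- Triples `(b, s, t)` indexing the counted words: `b` tells whether the hole or the second
letter `0` is at position `1`, `s` locates the other one, and `t` locates the letter `0` of the
second half, if any. -/
def wordIndices (m : ℕ) : Finset (Bool × Σ _ : ℕ, ℕ) :=
  Finset.univ ×ˢ (Finset.range (m - 2)).sigma fun s => Finset.range (s + 2)

/-- The counted word with a given index. -/
def indexedWord (m : ℕ) (x : Bool × Σ _ : ℕ, ℕ) : PWord (Fin 2) :=
  sparseWord m (bif x.1 then 1 else m - 1 - x.2.1) (bif x.1 then m - 1 - x.2.1 else 1)
    (m - 1 + x.2.2)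

theorem mem_wordIndices {m : ℕ} {b : Bool} {s t : ℕ} :
    (b, ⟨s, t⟩) ∈ wordIndices m ↔ s < m - 2 ∧ t < s + 2 := by
  simp [wordIndices]

theorem card_wordIndices (m : ℕ) (hm : 2 ≤ m) : (wordIndices m).card + m + 2 = m ^ 2 := by
  have hsum (k : ℕ) : 2 * ∑ s ∈ Finset.range k, (s + 2) = k * (k + 3) := by
    induction k with
    | zero => simp
    | succ k ih => rw [Finset.sum_range_succ, mul_add, ih]; ring
  obtain ⟨k, rfl⟩ := Nat.exists_eq_add_of_le' hm
  simp only [wordIndices, Finset.card_product, Finset.card_sigma, Finset.card_range,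
    Finset.card_univ, Fintype.card_bool, Nat.add_sub_cancel, hsum]
  ring

theorem indexedWord_injOn (m : ℕ) : Set.InjOn (indexedWord m) (wordIndices m) := by
  rintro ⟨b, s, t⟩ hx ⟨b', s', t'⟩ hx' h
  rw [Finset.mem_coe, mem_wordIndices] at hx hx'
  obtain ⟨h₁, h₂, h₃⟩ := sparseWord_inj (by cases b <;> simp <;> omega)
    (by cases b <;> simp; omega) (by cases b <;> simp <;> omega)
    (by cases b <;> simp <;> omega) (by simp) (by dsimp only; omega) (by simp)
    (by dsimp only; omega) h
  have ht : t = t' := by simpa using h₃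
  cases b <;> cases b' <;> simp only [cond_true, cond_false] at h₁ h₂
  · obtain rfl : s = s' := by omega
    rw [ht]
  · omega
  · omega
  · obtain rfl : s = s' := by omega
    rw [ht]

theorem setOf_isCounted {m : ℕ} (hm : 3 ≤ m) :
    {w | IsCounted m w} = indexedWord m '' (wordIndices m) := by
  ext w
  constructor
  · intro hw
    obtain ⟨i, p, q, hi, him, hp, hpm, hip, h1, hq, hqi, hqp, rfl⟩ :=
      IsCounted.exists_sparseWord hm hw
    by_cases h : i = 1
    · subst h
      refine ⟨(true, ⟨m - 1 - p, q - (m - 1)⟩), mem_wordIndices.2 (by omega), ?_⟩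
      simp only [indexedWord, cond_true]
      congr 1 <;> omega
    · obtain rfl : p = 1 := by omega
      refine ⟨(false, ⟨m - 1 - i, q - (m - 1)⟩), mem_wordIndices.2 (by omega), ?_⟩
      simp only [indexedWord, cond_false]
      congr 1 <;> omega
  · rintro ⟨⟨b, s, t⟩, hx, rfl⟩
    rw [Finset.mem_coe, mem_wordIndices] at hx
    cases b <;> refine isCounted_sparseWord ?_ ?_ ?_ ?_ ?_ ?_ ?_ ?_ <;> simp <;> omega

/-- For even `n ≥ 6`, the number of binary partial words of length `n` with exactly
one hole located at a position `i ≤ n/2 - 1`, whose first non-hole character is `0`,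
with exactly two occurrences of the letter `0` in the first half, and with minimal
abelian border length `n - 1`, is `n²/4 - n/2 - 2`. -/
theorem stmt_16 (n : ℕ) (hn : 6 ≤ n) (he : Even n) :
    Nat.card {w : PWord (Fin 2) // w.length = n ∧ w.countP (·.isNone) = 1 ∧
        (∃ i, i ≤ n / 2 - 1 ∧ w.getD i (some 0) = none) ∧
        FirstLetterIsZero w ∧
        (w.take (n / 2)).count (some 0) = 2 ∧
        IsLeast {k | HasAbelianBorder w k} (n - 1)} =
      n ^ 2 / 4 - n / 2 - 2 := by
  obtain ⟨m, rfl⟩ := he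
  have hhalf : (m + m) / 2 = m := by omega
  rw [hhalf]
  change Nat.card {w | IsCounted m w} = _
  rw [setOf_isCounted (by omega), Nat.card_image_of_injOn (indexedWord_injOn m)]
  have hcard := card_wordIndices m (by omega)
  have hsq : (m + m) ^ 2 / 4 = m ^ 2 := by
    rw [show (m + m) ^ 2 = 4 * m ^ 2 by ring, Nat.mul_div_cancel_left _ (by norm_num)]
  rw [hsq, Nat.card_eq_card_toFinset, Finset.toFinset_coe]
  omega
end

section
/- Let m > 1 be odd and let n ≥ 4 be even. If a binary partial word w of length n has exactly one hole, located at position 0, and exactly m distinct abelian borders, then w has abelian borders of lengths 1, n/2 and n−1; moreover, for every k with 1 ≤ k ≤ n/2 − 1, w has an abelian border of length k if and only if w has an abelian border of length n−k. -/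
theorem isCompletion_map_some {α : Type*} {t c : List α} :
    IsCompletion (t.map some) c ↔ c = t := by
  induction t generalizing c with
  | nil => simp [IsCompletion]
  | cons x t ih =>
    cases c with
    | nil => simp [IsCompletion]
    | cons y c => simpa [IsCompletion, eq_comm (a := x)] using fun _ => ih

theorem isCompletion_none_cons_map_some {α : Type*} {t c : List α} :
    IsCompletion (none :: t.map some) c ↔ ∃ a, c = a :: t := by
  cases c with
  | nil => simp [IsCompletion]
  | cons y c =>
    have h : List.Forall₂ (fun (o : Option α) a => ∀ x, o = some x → x = a) (t.map some) c ↔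
        c = t := isCompletion_map_some
    simp [IsCompletion, -List.forall₂_map_left_iff, h]

theorem abelianCompat_none_cons_map_some {α : Type*} {s t : List α} :
    AbelianCompat (none :: s.map some) (t.map some) ↔ ∃ a, (a :: s).Perm t := by
  simp only [AbelianCompat, isCompletion_none_cons_map_some, isCompletion_map_some]
  constructor
  · rintro ⟨_, _, ⟨a, rfl⟩, rfl, h⟩
    exact ⟨a, h⟩
  · rintro ⟨a, h⟩
    exact ⟨_, _, ⟨a, rfl⟩, rfl, h⟩

theorem hasAbelianBorder_none_cons_map_some {α : Type*} {t : List α} {k : ℕ} :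
    HasAbelianBorder (none :: t.map some) k ↔
      1 ≤ k ∧ k ≤ t.length ∧ ∃ a, (a :: t.take (k - 1)).Perm (t.drop (t.length - k)) := by
  simp only [HasAbelianBorder, List.length_cons, List.length_map, Nat.add_sub_cancel]
  refine and_congr_right fun h1 => and_congr_right fun h2 => ?_
  obtain ⟨j, rfl⟩ := Nat.exists_eq_add_of_le' h1
  rw [show t.length + 1 - (j + 1) = (t.length - (j + 1)) + 1 by omega, List.take_succ_cons,
    List.drop_succ_cons, ← List.map_take, ← List.map_drop, abelianCompat_none_cons_map_some,
    Nat.add_sub_cancel]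

/-- If two splittings of `t` satisfy `a :: t.take i ~ t.drop j`, then also
`a :: t.take j ~ t.drop i`. -/
theorem List.Perm.cons_take_drop_swap {α : Type*} {t : List α} {i j : ℕ} {a : α}
    (h : (a :: t.take i).Perm (t.drop j)) : (a :: t.take j).Perm (t.drop i) := by
  rw [← Multiset.coe_eq_coe] at h ⊢
  have e : ((t.take i : Multiset α)) + t.drop i = t.take j + t.drop j := by
    simp only [Multiset.coe_add, List.take_append_drop]
  rw [← h, ← Multiset.cons_coe, Multiset.add_cons, ← Multiset.cons_add, add_comm] at e
  rw [← Multiset.cons_coe]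
  exact (add_right_cancel e).symm

theorem HasAbelianBorder.sub_of_none_cons_map_some {α : Type*} {t : List α} {k : ℕ}
    (h : HasAbelianBorder (none :: t.map some) k) :
    HasAbelianBorder (none :: t.map some) (t.length + 1 - k) := by
  rw [hasAbelianBorder_none_cons_map_some] at h ⊢
  obtain ⟨h1, h2, a, ha⟩ := h
  refine ⟨by omega, by omega, a, ?_⟩
  rw [show t.length + 1 - k - 1 = t.length - k by omega,
    show t.length - (t.length + 1 - k) = k - 1 by omega]
  exact ha.cons_take_drop_swap

theorem hasAbelianBorder_one_of_none_cons_map_some {α : Type*} {t : List α}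
    (ht : 1 ≤ t.length) : HasAbelianBorder (none :: t.map some) 1 := by
  rw [hasAbelianBorder_none_cons_map_some]
  obtain ⟨a, ha⟩ := List.length_eq_one_iff.mp
    (show (t.drop (t.length - 1)).length = 1 by rw [List.length_drop]; omega)
  exact ⟨le_rfl, ht, a, by simp [ha]⟩

theorem List.exists_eq_none_cons_map_some {α : Type*} {w : List (Option α)} {d : α}
    (hhole : w.countP (·.isNone) = 1) (h0 : w.getD 0 (some d) = none) :
    ∃ t : List α, w = none :: t.map some := by
  cases w with
  | nil => simp at h0
  | cons o r =>
    obtain rfl : o = none := by simpa using h0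
    have hr : ∀ x ∈ r, x ≠ none := by simpa [List.countP_eq_zero] using hhole
    refine ⟨r.reduceOption, ?_⟩
    congr 1
    clear hhole h0
    induction r with
    | nil => rfl
    | cons x r ih =>
      obtain ⟨y, rfl⟩ := Option.ne_none_iff_exists'.mp (hr x (by simp))
      rw [List.reduceOption_cons_of_some, List.map_cons,
        ← ih fun x hx => hr x (List.mem_cons_of_mem _ hx)]

/-- A set of natural numbers in `[0, n]` of odd cardinality that is invariant under `k ↦ n - k`
contains a fixed point of that reflection. -/
theorem exists_two_mul_eq_of_odd_card {P : ℕ → Prop} {n : ℕ} (hle : ∀ k, P k → k ≤ n)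
    (hsymm : ∀ k, P k → P (n - k)) (hodd : Odd (Nat.card {k // P k})) :
    ∃ k, P k ∧ 2 * k = n := by
  have : Finite {k // P k} := ((Set.finite_Iic n).subset hle).to_subtype
  have := Fintype.ofFinite {k // P k}
  have hinv : Function.Involutive fun x : {k // P k} =>
      (⟨n - x, hsymm x x.2⟩ : {k // P k}) := fun x =>
    Subtype.ext (Nat.sub_sub_self (hle x x.2))
  obtain ⟨x, hx⟩ := Equiv.Perm.exists_fixed_point_of_prime (p := 2) (n := 1)
    (σ := hinv.toPerm) (by rwa [← Nat.card_eq_fintype_card, ← even_iff_two_dvd,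
      Nat.not_even_iff_odd])
    (by rw [pow_one, sq]; exact Equiv.ext hinv)
  have hx' : n - (x : ℕ) = x := congrArg Subtype.val hx
  have := hle x x.2
  exact ⟨x, x.2, by omega⟩

/-- Let `m > 1` be odd and `n ≥ 4` even. If a binary partial word `w` of length `n`
has exactly one hole, located at position `0`, and exactly `m` distinct abelian
borders, then `w` has abelian borders of lengths `1`, `n/2` and `n-1`, and for every
`1 ≤ k ≤ n/2 - 1`, `w` has an abelian border of length `k` iff it has one of length
`n - k`. -/
theorem stmt_18 (m n : ℕ) (hm : Odd m) (hm1 : 1 < m) (hn : 4 ≤ n) (he : Even n)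
    (w : PWord (Fin 2)) (hlen : w.length = n)
    (hhole : w.countP (·.isNone) = 1) (h0 : w.getD 0 (some 0) = none)
    (hcount : Nat.card {k // HasAbelianBorder w k} = m) :
    HasAbelianBorder w 1 ∧ HasAbelianBorder w (n / 2) ∧
      HasAbelianBorder w (n - 1) ∧
      ∀ k, 1 ≤ k → k ≤ n / 2 - 1 →
        (HasAbelianBorder w k ↔ HasAbelianBorder w (n - k)) := by
  obtain ⟨t, rfl⟩ := List.exists_eq_none_cons_map_some hhole h0
  have ht : t.length + 1 = n := by simpa using hlen
  have hsymm : ∀ k, HasAbelianBorder (none :: t.map some) k →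
      HasAbelianBorder (none :: t.map some) (n - k) := fun k hk =>
    ht ▸ hk.sub_of_none_cons_map_some
  have hone : HasAbelianBorder (none :: t.map some) 1 :=
    hasAbelianBorder_one_of_none_cons_map_some (by omega)
  refine ⟨hone, ?_, hsymm 1 hone, fun k _ hk => ⟨hsymm k, fun h => ?_⟩⟩
  · obtain ⟨k, hk, rfl⟩ := exists_two_mul_eq_of_odd_card
      (fun k hk => (hk.2.1.trans (Nat.sub_le _ _)).trans hlen.le) hsymm (hcount ▸ hm)
    rwa [Nat.mul_div_cancel_left k two_pos]
  · have := hsymm _ h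
    rwa [Nat.sub_sub_self (by omega)] at this
end
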